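/- The vector (0,1) belongs to Λ, and for every (a,b) ∈ Ω_∞ the vector g_{a,b}·(0,1) = (b, 1/a) satisfies 0 < b ≤ 1, has positive second coordinate, and has slope 1/(ab); moreover, for every v ∈ Λ such that g_{a,b}·v = (x,y) satisfies 0 < x ≤ 1 and y > 0, one has y/x ≥ 1/(ab). That is, g_{a,b}·(0,1) is the vector of smallest slope in g_{a,b}Λ ∩ ((0,1]×(0,∞)). -/

import Mathlib

open Matrix MeasureTheory Filter Topology

noncomputable section

abbrev SL2 := Matrix.SpecialLinearGroup (Fin 2) ℝ

/-- The golden ratio φ = (1+√5)/2. -/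
def phi : ℝ := (1 + Real.sqrt 5) / 2

/-- φ̄ = 1/φ. -/
def phib : ℝ := phi⁻¹

/-- S = [[0,−1],[1,0]]. -/
def Smat : SL2 := ⟨!![0, -1; 1, 0], by norm_num [Matrix.det_fin_two_of]⟩

/-- P = [[1,φ],[0,1]]. -/
def Pmat : SL2 := ⟨!![1, phi; 0, 1], by norm_num [Matrix.det_fin_two_of]⟩

/-- The Veech group of the golden L: the subgroup generated by S and P. -/
def Γ : Subgroup SL2 := Subgroup.closure {Smat, Pmat}

/-- Linear action of a 2×2 matrix on ℝ². -/
def mact (g : Matrix (Fin 2) (Fin 2) ℝ) (v : ℝ × ℝ) : ℝ × ℝ :=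
  (g 0 0 * v.1 + g 0 1 * v.2, g 1 0 * v.1 + g 1 1 * v.2)

/-- Λ = Γ·(1,0)ᵀ. -/
def Λ : Set (ℝ × ℝ) := {v | ∃ γ ∈ Γ, v = mact (γ : Matrix (Fin 2) (Fin 2) ℝ) (1, 0)}

/-- g_{a,b} = [[a,b],[0,1/a]]. -/
def gab (a b : ℝ) : Matrix (Fin 2) (Fin 2) ℝ := !![a, b; 0, a⁻¹]

/-- h_s = [[1,0],[−s,1]]. -/
def hmat (s : ℝ) : Matrix (Fin 2) (Fin 2) ℝ := !![1, 0; -s, 1]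

/-- Ω = {(a,b) : 0 < a ≤ 1, 1 − aφ < b ≤ 1}. -/
def Ω : Set (ℝ × ℝ) := {p | 0 < p.1 ∧ p.1 ≤ 1 ∧ 1 - p.1 * phi < p.2 ∧ p.2 ≤ 1}

/-- Ω₁ = {(a,b) ∈ Ω : φ̄ ≤ a ≤ 1, 1 − aφ < b ≤ φ̄ − a}. -/
def Ω₁ : Set (ℝ × ℝ) :=
  {p | p ∈ Ω ∧ phib ≤ p.1 ∧ p.1 ≤ 1 ∧ 1 - p.1 * phi < p.2 ∧ p.2 ≤ phib - p.1}

/-- Ω_φ = {(a,b) ∈ Ω : φ̄² ≤ a ≤ 1, φ̄ − a < b ≤ φ̄ − aφ̄}. -/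
def Ωphi : Set (ℝ × ℝ) :=
  {p | p ∈ Ω ∧ phib ^ 2 ≤ p.1 ∧ p.1 ≤ 1 ∧ phib - p.1 < p.2 ∧ p.2 ≤ phib - p.1 * phib}

/-- Ω_∞ = {(a,b) ∈ Ω : φ̄ − aφ̄ < b ≤ 1}. -/
def Ωinf : Set (ℝ × ℝ) := {p | p ∈ Ω ∧ phib - p.1 * phib < p.2 ∧ p.2 ≤ 1}

-- The return time function R.
open Classical in
noncomputable def Rfun (p : ℝ × ℝ) : ℝ :=
  if p ∈ Ω₁ then 1 / (p.1 * (p.1 + p.2))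
  else if p ∈ Ωphi then 1 / (p.1 * (p.1 * phib + p.2))
  else 1 / (p.1 * p.2)

/-- The probability measure m with dm = (2/φ) da db on Ω. -/
noncomputable def m : Measure (ℝ × ℝ) := ENNReal.ofReal (2 / phi) • volume.restrict Ω

-- The golden-L BCZ map T.
open Classical in
noncomputable def Tmap (p : ℝ × ℝ) : ℝ × ℝ :=
  if p ∈ Ω₁ then
    ((p.1 + p.2) * phi,
      p.1 + p.2 * phi +
        (-(⌊(p.1 + p.2 * phi - 1) / (phi ^ 2 * (p.1 + p.2))⌋ : ℤ) : ℝ) * phi ^ 2 * (p.1 + p.2))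
  else if p ∈ Ωphi then
    (p.1 + p.2 * phi,
      p.2 + (-(⌊(p.2 - 1) / (phi * (p.1 + p.2 * phi))⌋ : ℤ) : ℝ) * phi * (p.1 + p.2 * phi))
  else
    (p.2, -p.1 + (-(⌊(-p.1 - 1) / (phi * p.2)⌋ : ℤ) : ℝ) * phi * p.2)

theorem phi_sq : phi * phi = phi + 1 := by
  have h : Real.sqrt 5 * Real.sqrt 5 = 5 := Real.mul_self_sqrt (by norm_num)
  unfold phi
  linarith

theorem one_lt_phi : 1 < phi := by
  have h : (1 : ℝ) < Real.sqrt 5 := by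
    rw [Real.lt_sqrt] <;> norm_num
  unfold phi
  linarith

/-- The vectors obtained from the two standard basis vectors by repeatedly applying the four
matrices whose columns are consecutive terms of the sequence `(1,0)`, `(φ,1)`, `(φ,φ)`, `(1,φ)`,
`(0,1)`. -/
inductive QuadrantTree : ℝ → ℝ → Prop
  | fst : QuadrantTree 1 0
  | snd : QuadrantTree 0 1
  | sector_one {x y : ℝ} (h : QuadrantTree x y) : QuadrantTree (x + phi * y) y
  | sector_two {x y : ℝ} (h : QuadrantTree x y) :
      QuadrantTree (phi * x + phi * y) (x + phi * y)
  | sector_three {x y : ℝ} (h : QuadrantTree x y) :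
      QuadrantTree (phi * x + y) (phi * x + phi * y)
  | sector_four {x y : ℝ} (h : QuadrantTree x y) : QuadrantTree x (phi * x + y)

theorem QuadrantTree.of_eq {x y x' y' : ℝ} (h : QuadrantTree x y) (hx : x' = x) (hy : y' = y) :
    QuadrantTree x' y' := by
  subst hx hy
  exact h

/-- Coordinates are `0` or at least `1`, and they do not both vanish. -/
theorem QuadrantTree.coords {x y : ℝ} (h : QuadrantTree x y) :
    (x = 0 ∨ 1 ≤ x) ∧ (y = 0 ∨ 1 ≤ y) ∧ 1 ≤ x + y := by
  have h1 := one_lt_phi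
  induction h with
  | fst => norm_num
  | snd => norm_num
  | sector_one _ ih | sector_two _ ih | sector_three _ ih | sector_four _ ih =>
    obtain ⟨rfl | hx, rfl | hy, hxy⟩ := ih
    · norm_num at hxy
    all_goals refine ⟨?_, ?_, ?_⟩
    all_goals first
      | (left; ring; done)
      | (right; nlinarith)
      | nlinarith

/-- The tree together with its images under the rotations by multiples of a right angle. -/
def RotatedTree (v : ℝ × ℝ) : Prop :=
  QuadrantTree v.1 v.2 ∨ QuadrantTree (-v.1) (-v.2) ∨
    QuadrantTree (-v.2) v.1 ∨ QuadrantTree v.2 (-v.1)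

theorem RotatedTree.rot {x y : ℝ} (h : RotatedTree (x, y)) : RotatedTree (-y, x) := by
  simp only [RotatedTree, neg_neg] at h ⊢
  tauto

theorem RotatedTree.neg {x y : ℝ} (h : RotatedTree (x, y)) : RotatedTree (-x, -y) :=
  h.rot.rot

theorem RotatedTree.of_eq {x y x' y' : ℝ} (h : RotatedTree (x, y)) (hx : x' = x) (hy : y' = y) :
    RotatedTree (x', y') := by
  subst hx hy
  exact h

theorem QuadrantTree.elliptic {x y : ℝ} (h : QuadrantTree x y) :
    RotatedTree (phi * x - y, x) := by
  have h2 := phi_sq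
  cases h with
  | fst => exact Or.inl (QuadrantTree.snd.sector_one.of_eq (by ring) (by ring))
  | snd => exact Or.inr (Or.inl (QuadrantTree.fst.of_eq (by norm_num) (by norm_num)))
  | @sector_one x y h =>
    exact Or.inl (h.sector_two.of_eq (by linear_combination y * h2) (by ring))
  | @sector_two x y h =>
    exact Or.inl (h.sector_three.of_eq (by linear_combination (x + y) * h2) (by ring))
  | @sector_three x y h =>
    exact Or.inl (h.sector_four.of_eq (by linear_combination x * h2) (by ring))
  | @sector_four x y h =>
    exact Or.inr (Or.inr (Or.inr (h.of_eq (by ring) (by ring))))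

theorem QuadrantTree.elliptic_inv {x y : ℝ} (h : QuadrantTree x y) :
    RotatedTree (y, phi * y - x) := by
  have h2 := phi_sq
  cases h with
  | fst => exact Or.inr (Or.inl (QuadrantTree.snd.of_eq (by norm_num) (by norm_num)))
  | snd => exact Or.inl (QuadrantTree.snd.sector_three.of_eq (by ring) (by ring))
  | @sector_one x y h =>
    exact Or.inr (Or.inr (Or.inl (h.of_eq (by ring) (by ring))))
  | @sector_two x y h =>
    exact Or.inl (h.sector_one.of_eq (by ring) (by linear_combination y * h2))
  | @sector_three x y h =>
    exact Or.inl (h.sector_two.of_eq (by ring) (by linear_combination (x + y) * h2))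
  | @sector_four x y h =>
    exact Or.inl (h.sector_three.of_eq (by ring) (by linear_combination x * h2))

theorem RotatedTree.parabolic {x y : ℝ} (h : RotatedTree (x, y)) :
    RotatedTree (x + phi * y, y) := by
  rcases h with h | h | h | h
  · exact Or.inl h.sector_one
  · exact Or.inr (Or.inl (h.sector_one.of_eq (by ring) rfl))
  · exact h.elliptic.neg.of_eq (by ring) (by ring)
  · exact h.elliptic.of_eq (by ring) rfl

theorem RotatedTree.parabolic_inv {x y : ℝ} (h : RotatedTree (x, y)) :
    RotatedTree (x - phi * y, y) := by
  rcases h with h | h | h | h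
  · exact h.elliptic_inv.rot.of_eq (by ring) rfl
  · exact h.elliptic_inv.rot.neg.of_eq (by ring) (by ring)
  · exact Or.inr (Or.inr (Or.inl (h.sector_four.of_eq rfl (by ring))))
  · exact Or.inr (Or.inr (Or.inr (h.sector_four.of_eq rfl (by ring))))

theorem mact_mul (g h : SL2) (v : ℝ × ℝ) :
    mact ((g * h : SL2) : Matrix (Fin 2) (Fin 2) ℝ) v = mact g (mact h v) := by
  change mact ((g : Matrix (Fin 2) (Fin 2) ℝ) * (h : Matrix (Fin 2) (Fin 2) ℝ)) v = _
  simp only [mact, Matrix.mul_apply, Fin.sum_univ_two]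
  ext <;> ring

theorem mact_inv (g : SL2) (v : ℝ × ℝ) :
    mact ((g⁻¹ : SL2) : Matrix (Fin 2) (Fin 2) ℝ) v =
      (g.1 1 1 * v.1 - g.1 0 1 * v.2, g.1 0 0 * v.2 - g.1 1 0 * v.1) := by
  change mact (Matrix.adjugate g.1) v = _
  simp only [mact, Matrix.adjugate_fin_two, Matrix.of_apply, Matrix.cons_val', Matrix.cons_val_zero,
    Matrix.cons_val_one, Matrix.cons_val_fin_one]
  ext <;> ring

theorem rotatedTree_mact {γ : SL2} (hγ : γ ∈ Γ) :
    ∀ {v : ℝ × ℝ}, RotatedTree v → RotatedTree (mact γ v) := by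
  unfold Γ at hγ
  induction hγ using Subgroup.closure_induction'' with
  | one =>
    intro v hv
    simpa [mact] using hv
  | mem g hg =>
    rintro ⟨x, y⟩ hv
    rcases hg with rfl | rfl
    · simpa [mact, Smat] using hv.rot
    · simpa [mact, Pmat] using hv.parabolic
  | inv_mem g hg =>
    rintro ⟨x, y⟩ hv
    rw [mact_inv]
    rcases hg with rfl | rfl
    · simpa [Smat] using hv.rot.neg
    · simpa [Pmat] using hv.parabolic_inv
  | mul g h _ _ ihg ihh =>
    intro v hv
    rw [mact_mul]
    exact ihg (ihh hv)

theorem quadrantTree_of_mem_Λ {x y : ℝ} (h : (x, y) ∈ Λ) (hx : 0 < x) (hy : 0 < y) :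
    QuadrantTree x y := by
  obtain ⟨γ, hγ, hv⟩ := h
  have ht : RotatedTree (x, y) := hv ▸ rotatedTree_mact hγ (Or.inl QuadrantTree.fst)
  rcases ht with h | h | h | h
  · exact h
  all_goals
    obtain ⟨h1, h2, -⟩ := h.coords
    rcases h1 with h1 | h1 <;> rcases h2 with h2 | h2 <;> simp only at h1 h2 <;> linarith

/-- A linear form with nonnegative coefficients exceeding `1` at `(φ,1)`, `(φ,φ)` and `(1,φ)`
exceeds `1` at every vector of the tree lying in the open quadrant. -/
theorem QuadrantTree.one_lt_form {a b x y : ℝ} (h : QuadrantTree x y) (hx : 0 < x) (hy : 0 < y)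
    (ha : 0 ≤ a) (hb : 0 ≤ b) (h1 : 1 < a * phi + b) (h2 : 1 < (a + b) * phi)
    (h3 : 1 < a + b * phi) : 1 < a * x + b * y := by
  have of_coords {s t p q : ℝ} (hs : s = 0 ∨ 1 ≤ s) (ht : t = 0 ∨ 1 ≤ t) (hst : 1 ≤ s + t)
      (hp : 1 < p) (hq : 1 < q) : 1 < s * p + t * q := by
    rcases hs with rfl | hs <;> rcases ht with rfl | ht <;> nlinarith
  cases h with
  | fst => exact absurd hy (lt_irrefl _)
  | snd => exact absurd hx (lt_irrefl _)
  | @sector_one x y h =>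
    obtain ⟨hx', hy', -⟩ := h.coords
    have hx0 : 0 ≤ x := by rcases hx' with h | h <;> linarith
    have h_one : 1 ≤ y := by rcases hy' with h | h <;> linarith
    nlinarith [mul_nonneg ha hx0]
  | @sector_two x y h =>
    obtain ⟨hx', hy', hxy⟩ := h.coords
    linarith [of_coords hx' hy' hxy h1 h2]
  | @sector_three x y h =>
    obtain ⟨hx', hy', hxy⟩ := h.coords
    linarith [of_coords hx' hy' hxy h2 h3]
  | @sector_four x y h =>
    obtain ⟨hx', hy', -⟩ := h.coords
    have h_one : 1 ≤ x := by rcases hx' with h | h <;> linarith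
    have hy0 : 0 ≤ y := by rcases hy' with h | h <;> linarith
    nlinarith [mul_nonneg hb hy0]

/-- On Ω_∞, the vector g_{a,b}·(0,1) = (b, 1/a) is the vector of smallest slope in
g_{a,b}Λ ∩ ((0,1]×(0,∞)), with slope 1/(ab). -/
theorem smallest_slope_Omega_inf :
    ((0 : ℝ), (1 : ℝ)) ∈ Λ ∧
    ∀ a b : ℝ, (a, b) ∈ Ωinf →
      (mact (gab a b) (0, 1) = (b, 1 / a) ∧
        0 < b ∧ b ≤ 1 ∧ 0 < 1 / a ∧
        (1 / a) / b = 1 / (a * b)) ∧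
      ∀ v ∈ Λ, 0 < (mact (gab a b) v).1 → (mact (gab a b) v).1 ≤ 1 →
        0 < (mact (gab a b) v).2 →
        1 / (a * b) ≤ (mact (gab a b) v).2 / (mact (gab a b) v).1 := by
  have hphi := one_lt_phi
  refine ⟨⟨Smat, Subgroup.subset_closure (by simp), by simp [mact, Smat]⟩, ?_⟩
  rintro a b ⟨⟨ha, ha1, hab, hb1⟩, hinf, -⟩
  simp only at ha ha1 hab hb1 hinf
  have hbar : phib * phi = 1 := inv_mul_cancel₀ (by linarith)
  have hbar0 : 0 < phib := inv_pos.2 (by linarith)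
  have hb : 0 < b := by nlinarith
  refine ⟨⟨by simp [mact, gab], hb, hb1, by positivity, by rw [div_div]⟩, ?_⟩
  rintro ⟨x, y⟩ hv h1 h2 h3
  simp only [mact, gab, Matrix.of_apply, Matrix.cons_val', Matrix.cons_val_zero,
    Matrix.cons_val_one, Matrix.cons_val_fin_one, zero_mul, zero_add] at h1 h2 h3 ⊢
  have hy : 0 < y := pos_of_mul_pos_right h3 (inv_nonneg.2 ha.le)
  have hx : x ≤ 0 := by
    by_contra! hx
    have hform : 1 < a + b * phi := by
      have := mul_lt_mul_of_pos_right hinf (by linarith : 0 < phi)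
      linear_combination this - (1 - a) * hbar
    have hsum : 1 < (a + b) * phi := by nlinarith
    have := (quadrantTree_of_mem_Λ hv hx hy).one_lt_form hx hy ha.le hb.le
      (by linarith) hsum hform
    linarith
  rw [div_le_div_iff₀ (by positivity) h1]
  have hcancel : a⁻¹ * y * (a * b) = b * y := by field_simp
  nlinarith
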